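/- If f : X → (−∞,∞] is a convex function and ∂f(x) ≠ ∅ for some x ∈ dom f, then f has bounded decay rate: there exists a constant c ≥ 0 such that the function y ↦ f(y) + c·d(x,y) is bounded below on X. -/

import Mathlib

/-!
Basic convex analysis in metric spaces with bounded curvature:
common definitions (geodesics, Alexandrov angles, tangent-space elements,
normal cones, subdifferentials, CAT(κ) conditions).
-/

open Metric Real Set Filter

noncomputable section

namespace CATPaper

/-- A geodesic of length `l` in a metric space `X`: a map `ℝ → X` that is isometric
on `[0, l]` (values outside `[0, l]` are irrelevant). -/
structure Geodesic (X : Type*) [MetricSpace X] where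
  l : ℝ
  l_nonneg : 0 ≤ l
  map : ℝ → X
  isom : ∀ s ∈ Set.Icc (0:ℝ) l, ∀ t ∈ Set.Icc (0:ℝ) l, dist (map s) (map t) = |s - t|

variable {X : Type*} [MetricSpace X]

/-- The constant geodesic at a point. -/
def constGeod (x : X) : Geodesic X :=
  ⟨0, le_rfl, fun _ => x, by
    rintro s ⟨hs0, hs1⟩ t ⟨ht0, ht1⟩
    have : s = t := by nlinarith
    simp [this]⟩

/-- `γ` is a geodesic from `x` to `y` (parametrized by arclength on `[0, d(x,y)]`). -/
def GeodesicFromTo (γ : Geodesic X) (x y : X) : Prop :=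
  γ.map 0 = x ∧ γ.l = dist x y ∧ γ.map γ.l = y

/-- Every two points of `X` are joined by a geodesic. -/
def GeodesicSpace (X : Type*) [MetricSpace X] : Prop :=
  ∀ x y : X, ∃ γ : Geodesic X, GeodesicFromTo γ x y

/-- Every two points of `X` are joined by a unique geodesic segment. -/
def UniquelyGeodesic (X : Type*) [MetricSpace X] : Prop :=
  ∀ (x y : X) (γ η : Geodesic X), GeodesicFromTo γ x y → GeodesicFromTo η x y →
    ∀ t ∈ Set.Icc (0:ℝ) (dist x y), γ.map t = η.map t

/-- The geodesic extension property around `x` with constant `R`: any geodesic between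
distinct points `y, z ∈ B(x,R)` with `d(y,z) < R` extends beyond `z` to a geodesic of
length `R`. -/
def GeodExtAround (x : X) (R : ℝ) : Prop :=
  ∀ y z : X, y ∈ Metric.ball x R → z ∈ Metric.ball x R → y ≠ z → dist y z < R →
    ∃ γ : Geodesic X, γ.l = R ∧ γ.map 0 = y ∧ γ.map (dist y z) = z

/-- The (global) geodesic extension property: every nondegenerate geodesic segment is
contained in a geodesic line. -/
def GeodExtGlobal (X : Type*) [MetricSpace X] : Prop :=
  ∀ γ : Geodesic X, 0 < γ.l → ∃ g : ℝ → X,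
    (∀ s t : ℝ, dist (g s) (g t) = |s - t|) ∧ ∀ t ∈ Set.Icc (0:ℝ) γ.l, g t = γ.map t

/-- The Euclidean comparison angle at the vertex `x` of the triple `(p, x, q)`. -/
def compAngle (x p q : X) : ℝ :=
  Real.arccos ((dist x p ^ 2 + dist x q ^ 2 - dist p q ^ 2) / (2 * dist x p * dist x q))

/-- The Alexandrov angle between two geodesics issuing at the same point: the limit as
`s, t ↘ 0` of the Euclidean comparison angles (junk value if the limit does not exist). -/
def alexAngle (γ η : Geodesic X) : ℝ :=
  limUnder ((nhdsWithin (0:ℝ) (Set.Ioi 0)) ×ˢ (nhdsWithin (0:ℝ) (Set.Ioi 0)))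
    (fun p : ℝ × ℝ => compAngle (γ.map 0) (γ.map p.1) (η.map p.2))

/-- `([γ], r)` is an element of the tangent space at `x`: `γ` issues at `x`, `r ≥ 0`, and
`γ` is nonconstant unless `r = 0` (in which case `([γ], r)` is the origin `o_x`). -/
def InTangent (x : X) (γ : Geodesic X) (r : ℝ) : Prop :=
  γ.map 0 = x ∧ 0 ≤ r ∧ (r = 0 ∨ 0 < γ.l)

/-- Equality of directions `[γ] = [η]` (equivalence classes under zero Alexandrov angle;
constant geodesics all represent the degenerate direction). -/
def DirEq (γ η : Geodesic X) : Prop :=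
  (γ.l = 0 ∧ η.l = 0) ∨ (0 < γ.l ∧ 0 < η.l ∧ alexAngle γ η = 0)

/-- The scalar product `⟨([γ], r), ([η], s)⟩ = r·s·cos ∠(γ, η)` of two tangent-space
elements. -/
def tInner (γ : Geodesic X) (r : ℝ) (η : Geodesic X) (s : ℝ) : ℝ :=
  r * s * Real.cos (alexAngle γ η)

/-- The tangent-space elements `([γ], r)` and `([η], s)` are opposite to each other. -/
def TanOpposite (γ : Geodesic X) (r : ℝ) (η : Geodesic X) (s : ℝ) : Prop :=
  (r = 0 ∧ s = 0) ∨ (r = s ∧ 0 < r ∧ alexAngle γ η = π)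

/-- The metric projection of `z` onto `C`: the set of points of `C` nearest to `z`. -/
def projSet (C : Set X) (z : X) : Set X :=
  {y ∈ C | ∀ c ∈ C, dist z y ≤ dist z c}

/-- A set is convex if it contains every geodesic segment between its points. -/
def GConvex (C : Set X) : Prop :=
  ∀ γ : Geodesic X, γ.map 0 ∈ C → γ.map γ.l ∈ C → ∀ t ∈ Set.Icc (0:ℝ) γ.l, γ.map t ∈ C

/-- `([γ], r)` belongs to the normal cone of `C` at `x`: `r = 0`, or `x` is the metric
projection onto `C` of `γ(t)` for some `t > 0`. -/
def InNormalCone (C : Set X) (x : X) (γ : Geodesic X) (r : ℝ) : Prop :=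
  r = 0 ∨ ∃ t : ℝ, 0 < t ∧ t ≤ γ.l ∧ projSet C (γ.map t) = {x}

/-- The diameter `D_κ = π/√κ` of the model space `M_κ²` for `κ > 0`. -/
def Dk (κ : ℝ) : ℝ := π / Real.sqrt κ

/-- The comparison distance in the model sphere `M_κ²` of curvature `κ > 0`: the distance
from the vertex `p̄` to the point at arclength `t` along the side `q̄ r̄` of a comparison
triangle with `d(q,r) = a`, `d(p,q) = b`, `d(p,r) = c`, computed via the spherical law of
cosines. -/
def modelCompDist (κ a b c t : ℝ) : ℝ :=
  (1 / Real.sqrt κ) * Real.arccos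
    (Real.cos (Real.sqrt κ * b) * Real.cos (Real.sqrt κ * t) +
      Real.sin (Real.sqrt κ * b) * Real.sin (Real.sqrt κ * t) *
        ((Real.cos (Real.sqrt κ * c) - Real.cos (Real.sqrt κ * a) * Real.cos (Real.sqrt κ * b)) /
          (Real.sin (Real.sqrt κ * a) * Real.sin (Real.sqrt κ * b))))

/-- `X` is a `CAT(κ)` space for `κ > 0`: every two points at distance `< D_κ` are joined
by a geodesic, and every geodesic triangle of perimeter `< 2 D_κ` is no thicker than its
comparison triangle in the model sphere `M_κ²`. -/
def IsCATK (κ : ℝ) (X : Type*) [MetricSpace X] : Prop :=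
  (∀ x y : X, dist x y < Dk κ → ∃ γ : Geodesic X, GeodesicFromTo γ x y) ∧
  (∀ (p : X) (σ : Geodesic X),
    dist p (σ.map 0) + dist p (σ.map σ.l) + σ.l < 2 * Dk κ →
    ∀ t ∈ Set.Icc (0:ℝ) σ.l,
      dist p (σ.map t) ≤ modelCompDist κ σ.l (dist p (σ.map 0)) (dist p (σ.map σ.l)) t)

/-- `X` is a `CAT(0)` space: a geodesic space satisfying the `CAT(0)` comparison
inequality `d(z, γ(t·l))² ≤ (1-t)·d(z,γ(0))² + t·d(z,γ(l))² - t(1-t)·l²`. -/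
def IsCAT0 (X : Type*) [MetricSpace X] : Prop :=
  GeodesicSpace X ∧
  ∀ (z : X) (γ : Geodesic X), ∀ t ∈ Set.Icc (0:ℝ) 1,
    dist z (γ.map (t * γ.l)) ^ 2 ≤
      (1 - t) * dist z (γ.map 0) ^ 2 + t * dist z (γ.map γ.l) ^ 2 - t * (1 - t) * γ.l ^ 2

/-- The standing assumptions of the paper: `(X,d)` is a locally compact, uniquely geodesic
`CAT(κ)` space (`κ > 0`) having, around every point `x`, the geodesic extension property
with a constant `R x < D_κ/2`. -/
structure Standing (κ : ℝ) (X : Type*) [MetricSpace X] (R : X → ℝ) : Prop where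
  kpos : 0 < κ
  locComp : LocallyCompactSpace X
  cat : IsCATK κ X
  geod : GeodesicSpace X
  unique : UniquelyGeodesic X
  Rpos : ∀ x : X, 0 < R x
  Rsmall : ∀ x : X, R x < Dk κ / 2
  ext : ∀ x : X, GeodExtAround x (R x)

/-- A function `f : X → (-∞, ∞]` is convex if
`f(γ(t·l)) ≤ (1-t)·f(γ(0)) + t·f(γ(l))` along every geodesic. -/
def GConvexFn (f : X → EReal) : Prop :=
  ∀ (γ : Geodesic X), ∀ t ∈ Set.Icc (0:ℝ) 1,
    f (γ.map (t * γ.l)) ≤ ((1 - t : ℝ) : EReal) * f (γ.map 0) + (t : EReal) * f (γ.map γ.l)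

/-- The product `X × ℝ` equipped with the metric
`d₂((x₁,λ₁),(x₂,λ₂)) = √(d(x₁,x₂)² + |λ₁-λ₂|²)`. -/
abbrev XR (X : Type*) [MetricSpace X] : Type _ := WithLp 2 (X × ℝ)

/-- The point `(x, a)` of `X × ℝ`. -/
def toXR (x : X) (a : ℝ) : XR X := (WithLp.equiv 2 (X × ℝ)).symm (x, a)

/-- The epigraph of `f : X → (-∞, ∞]`, as a subset of `X × ℝ`. -/
def epigraph (f : X → EReal) : Set (XR X) :=
  {p : XR X | f ((WithLp.equiv 2 (X × ℝ)) p).1 ≤ ((((WithLp.equiv 2 (X × ℝ)) p).2 : ℝ) : EReal)}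

/-- `([γ], r) ∈ ∂f(x)`: the geodesic `σ(t) = (γ(rt/√(r²+1)), f(x) - t/√(r²+1))`,
`t ∈ [0, R₀]`, in `X × ℝ` satisfies `([σ], 1) ∈ N_{epi f}(x, f(x))`. -/
def IsSubgrad (R₀ : ℝ) (f : X → EReal) (x : X) (γ : Geodesic X) (r : ℝ) : Prop :=
  ∃ σ : Geodesic (XR X), σ.l = R₀ ∧
    (∀ t : ℝ, σ.map t =
      toXR (γ.map (r * t / Real.sqrt (r ^ 2 + 1)))
        ((f x).toReal - t / Real.sqrt (r ^ 2 + 1))) ∧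
    InNormalCone (epigraph f) (toXR x (f x).toReal) σ 1

/-- `([γ], r) ∈ ∂f(x)` in the `CAT(0)` setting, where the defining geodesic `σ` may be
taken on any interval `[0, l]`, `l > 0`. -/
def IsSubgrad0 (f : X → EReal) (x : X) (γ : Geodesic X) (r : ℝ) : Prop :=
  ∃ σ : Geodesic (XR X), 0 < σ.l ∧
    (∀ t : ℝ, σ.map t =
      toXR (γ.map (r * t / Real.sqrt (r ^ 2 + 1)))
        ((f x).toReal - t / Real.sqrt (r ^ 2 + 1))) ∧
    InNormalCone (epigraph f) (toXR x (f x).toReal) σ 1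

end CATPaper

namespace CATPaper

theorem dist_toXR {X : Type*} [MetricSpace X] (x y : X) (a b : ℝ) :
    dist (toXR x a) (toXR y b) = √(dist x y ^ 2 + (a - b) ^ 2) := by
  rw [WithLp.prod_dist_eq_add (by norm_num)]
  simp [toXR, Real.dist_eq, sq_abs, Real.sqrt_eq_rpow]

theorem toXR_mem_epigraph {X : Type*} [MetricSpace X] {f : X → EReal} {x : X} {a : ℝ} :
    toXR x a ∈ epigraph f ↔ f x ≤ (a : EReal) :=
  Iff.rfl

theorem mul_le_of_forall_sq_le {a h D M : ℝ}
    (H : ∀ t ∈ Set.Ioc (0 : ℝ) 1, a ^ 2 + h ^ 2 ≤ (a + t * D) ^ 2 + (h - t * M) ^ 2) :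
    h * M ≤ a * D := by
  by_contra! hlt
  have hK : 0 < D ^ 2 + M ^ 2 + 1 := by positivity
  set t := min 1 ((h * M - a * D) / (D ^ 2 + M ^ 2 + 1)) with ht_def
  have ht : 0 < t := lt_min one_pos (div_pos (sub_pos.2 hlt) hK)
  have hle : t * (D ^ 2 + M ^ 2 + 1) ≤ h * M - a * D :=
    (le_div_iff₀ hK).1 (min_le_right _ _)
  have := H t ⟨ht, min_le_left _ _⟩
  nlinarith [mul_le_mul_of_nonneg_left hle ht.le, mul_pos ht (sub_pos.2 hlt), mul_pos ht ht]

/-- If `(x, F)` is a nearest point of the epigraph of a convex function `f` to a point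
`(u, F - h)`, then `f` decays from `x` at rate at most `d(u, x) / h`. -/
theorem mul_sub_le_of_nearest {X : Type*} [MetricSpace X] {f : X → EReal}
    (hgeod : GeodesicSpace X) (hconv : GConvexFn f)
    {x u : X} {F h : ℝ} (hF : f x = F)
    (hnear : ∀ p ∈ epigraph f, dist (toXR u (F - h)) (toXR x F) ≤ dist (toXR u (F - h)) p)
    {y : X} {G : ℝ} (hG : f y = G) :
    h * (F - G) ≤ dist u x * dist x y := by
  obtain ⟨η, h0, hl, h1⟩ := hgeod x y
  refine mul_le_of_forall_sq_le fun t ht => ?_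
  have hmem : toXR (η.map (t * η.l)) ((1 - t) * F + t * G) ∈ epigraph f := by
    have := hconv η t ⟨ht.1.le, ht.2⟩
    rw [h0, h1, hF, hG] at this
    rw [toXR_mem_epigraph]
    exact_mod_cast this
  have hd := hnear _ hmem
  rw [dist_toXR, dist_toXR, Real.sqrt_le_sqrt_iff (by positivity)] at hd
  have hxη : dist x (η.map (t * η.l)) = t * dist x y := by
    have hnn := η.l_nonneg
    have := η.isom 0 ⟨le_rfl, hnn⟩ (t * η.l)
      ⟨mul_nonneg ht.1.le hnn, mul_le_of_le_one_left hnn ht.2⟩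
    rw [h0, zero_sub, abs_neg, abs_of_nonneg (mul_nonneg ht.1.le hnn)] at this
    rw [this, hl]
  have htri : dist u (η.map (t * η.l)) ≤ dist u x + t * dist x y :=
    hxη ▸ dist_triangle _ _ _
  have := pow_le_pow_left₀ dist_nonneg htri 2
  linarith

/-- Remark 4.12: if `f : X → (-∞,∞]` is convex and `∂f(x) ≠ ∅` for some `x ∈ dom f`,
then `f` has bounded decay rate: there is `c ≥ 0` such that `y ↦ f(y) + c·d(x,y)` is
bounded below. -/
theorem statement13 {X : Type*} [MetricSpace X] {κ : ℝ} {R : X → ℝ} (hX : Standing κ X R)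
    (f : X → EReal) (hfbot : ∀ y, f y ≠ ⊥) (hconv : GConvexFn f)
    (x : X) (hx : f x < ⊤)
    (hsub : ∃ (γ : Geodesic X) (r : ℝ), InTangent x γ r ∧ IsSubgrad (R x) f x γ r) :
    ∃ c : ℝ, 0 ≤ c ∧ ∃ m : ℝ,
      ∀ y : X, ((m : ℝ) : EReal) ≤ f y + ((c * dist x y : ℝ) : EReal) := by
  obtain ⟨γ, r, -, σ, -, hσ, hN⟩ := hsub
  obtain hN | ⟨t, ht, -, hproj⟩ := hN
  · exact absurd hN one_ne_zero
  lift f x to ℝ using ⟨hx.ne, hfbot x⟩ with F hF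
  rw [EReal.toReal_coe] at hproj
  simp only [EReal.toReal_coe] at hσ
  have hnear := (hproj.symm ▸ Set.mem_singleton _ : toXR x F ∈ projSet (epigraph f) (σ.map t)).2
  rw [hσ] at hnear
  set h := t / √(r ^ 2 + 1)
  set u := γ.map (r * t / √(r ^ 2 + 1))
  have hh : 0 < h := by positivity
  refine ⟨dist u x / h, by positivity, F, fun y => ?_⟩
  rcases eq_or_ne (f y) ⊤ with hy | hy
  · rw [hy, EReal.top_add_coe]
    exact le_top
  lift f y to ℝ using ⟨hy, hfbot y⟩ with G hG
  have key := mul_sub_le_of_nearest hX.geod hconv hF.symm hnear hG.symm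
  have : F - G ≤ dist u x / h * dist x y := by
    rw [div_mul_eq_mul_div, le_div_iff₀ hh]
    linarith
  norm_cast
  linarith

end CATPaper
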